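/- Let Λ be a positive definite diagonal d×d real matrix, β, γ ∈ (0,1), μ ≥ 0, τ ∈ (0,1), and set η := √(γ(1+β)/(1+β²)). Fix an integer k ≥ 3. Let a_{k−4}, a_{k−3}, a_{k−2}, a_{k−1}, a_k be positive reals, ω_{k−3}, ω_{k−2}, ω_{k−1} ∈ (0,1], and θ_{k−3}, θ_{k−2}, θ_{k−1}, θ_k positive reals with θ_{k−1} = θ_k·ω_{k−1}, θ_{k−2} = θ_{k−1}·ω_{k−2}, θ_{k−3} = θ_{k−2}·ω_{k−3}. Let F : ℝ^d → ℝ^d, let u_{k−3}, u_{k−2}, u_{k−1}, u_k, u_{k+1} ∈ ℝ^d, let F̃_{k−2}, F̃_{k−1}, F̃_k ∈ ℝ^d, and let L_k, L̂_{k−2}, L̂_{k−1} be positive reals such that ‖F(u_k) − F(u_{k−1})‖_{Λ⁻¹} ≤ L_k‖u_k − u_{k−1}‖_Λ, ‖F(u_{k−1}) − F̃_{k−1}‖_{Λ⁻¹} ≤ L̂_{k−1}‖u_{k−1} − u_{k−2}‖_Λ, and ‖F(u_{k−2}) − F̃_{k−2}‖_{Λ⁻¹} ≤ L̂_{k−2}‖u_{k−2}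 − u_{k−3}‖_Λ. Define F̄_j := F̃_j + (a_{j−1}ω_{j−1}/a_j)(F(u_{j−1}) − F̃_{j−1}) for j ∈ {k−1, k}, c_j := θ_j a_j(βμa_{j−1} + 1)/(β a_{j−1}) for j ∈ {k−3, k−2, k−1, k}, and E_k := a_k⟨F(u_k) − F̃_k, u_k − u_{k+1}⟩ + a_k⟨F̄_k − F̄_{k−1}, u_k − u_{k+1}⟩ − (γω_{k−1}(1+β)/(2(1+ω_{k−1})(1+β²)) + a_k(1 + βμa_{k−1})/(2β a_{k−1}))·‖u_{k+1} − u_k‖_Λ². Assume the four step size conditions: a_k ≤ (η√τ/(2√3·L_k))·(ω_{k−1}/√(1+ω_{k−1}))·√(a_{k−1}(βμa_{k−2}+1)/(β a_{k−2})); a_k ≤ (η√τ/(2√3·L̂_{k−1}))·(ω_{k−1}√(ω_{k−2})/√(1+ω_{k−1}))·√(a_{k−2}(βμa_{k−3}+1)/(β a_{k−3})); a_{k−1} ≤ (η√(1−τ)/(2·L̂_{k−1}))·(√(ω_{k−2})/√(1+ω_{k−1}))·√(a_{k−2}(βμa_{k−3}+1)/(β a_{k−3})); and a_k ≤ (η√τ/(2√3·L̂_{k−2}))·(ω_{k−1}/√(1+ω_{k−1}))·√(ω_{k−3}/ω_{k−2})·(a_{k−1}/a_{k−2})·√(a_{k−3}(βμa_{k−4}+1)/(β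 a_{k−4})). Then θ_k·E_k ≤ −(c_k/2)‖u_{k+1} − u_k‖_Λ² + (c_{k−1}/8)‖u_k − u_{k−1}‖_Λ² + (c_{k−2}/4)‖u_{k−1} − u_{k−2}‖_Λ² + (c_{k−3}/8)‖u_{k−2} − u_{k−3}‖_Λ². -/

import Mathlib

open Finset

/-- Squared Mahalanobis (semi)norm `‖x‖_Λ² = ∑ i, Λ i * (x i)²` for a diagonal
matrix with diagonal entries `Λ`. -/
noncomputable def mSq {d : ℕ} (Λ : Fin d → ℝ) (x : Fin d → ℝ) : ℝ :=
  ∑ i, Λ i * x i ^ 2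

/-- Mahalanobis norm `‖x‖_Λ`. -/
noncomputable def mNorm {d : ℕ} (Λ : Fin d → ℝ) (x : Fin d → ℝ) : ℝ :=
  Real.sqrt (mSq Λ x)

/-- Mahalanobis norm `‖x‖_{Λ⁻¹}` with respect to the inverse diagonal matrix. -/
noncomputable def mInvNorm {d : ℕ} (Λ : Fin d → ℝ) (x : Fin d → ℝ) : ℝ :=
  Real.sqrt (∑ i, (Λ i)⁻¹ * x i ^ 2)

/-- Standard inner product on `ℝ^d`. -/
noncomputable def dotR {d : ℕ} (x y : Fin d → ℝ) : ℝ := ∑ i, x i * y i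

/-- Generalized Cauchy–Schwarz inequality for the Mahalanobis norms. -/
theorem dotR_le_mInvNorm_mul_mNorm {d : ℕ} {Λ : Fin d → ℝ} (hΛ : ∀ i, 0 < Λ i)
    (x y : Fin d → ℝ) : dotR x y ≤ mInvNorm Λ x * mNorm Λ y := by
  have h := Real.sum_mul_le_sqrt_mul_sqrt Finset.univ
    (fun i => (Real.sqrt (Λ i))⁻¹ * x i) (fun i => Real.sqrt (Λ i) * y i)
  simp only [mul_pow, inv_pow, Real.sq_sqrt (hΛ _).le] at h
  refine le_trans (le_of_eq (Finset.sum_congr rfl fun i _ => ?_)) h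
  have := (Real.sqrt_pos.2 (hΛ i)).ne'
  field_simp

theorem mSq_nonneg {d : ℕ} {Λ : Fin d → ℝ} (hΛ : ∀ i, 0 < Λ i) (x : Fin d → ℝ) :
    0 ≤ mSq Λ x :=
  Finset.sum_nonneg fun i _ => mul_nonneg (hΛ i).le (sq_nonneg _)

theorem mSq_sub_comm {d : ℕ} (Λ : Fin d → ℝ) (x y : Fin d → ℝ) :
    mSq Λ (x - y) = mSq Λ (y - x) :=
  Finset.sum_congr rfl fun i _ => by simp only [Pi.sub_apply]; ring

theorem mInvNorm_neg {d : ℕ} (Λ : Fin d → ℝ) (x : Fin d → ℝ) :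
    mInvNorm Λ (-x) = mInvNorm Λ x := by
  simp [mInvNorm]

theorem mul_dotR_le_of_sq_le {d : ℕ} {Λ : Fin d → ℝ} (hΛ : ∀ i, 0 < Λ i)
    {x y z : Fin d → ℝ} {s L p q : ℝ} (hs : 0 ≤ s) (hp : 0 < p)
    (hx : mInvNorm Λ x ≤ L * mNorm Λ z) (h : (s * L) ^ 2 ≤ 4 * p * q) :
    s * dotR x y ≤ p * mSq Λ y + q * mSq Λ z := by
  have hy : mNorm Λ y ^ 2 = mSq Λ y := Real.sq_sqrt (mSq_nonneg hΛ y)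
  have hz : mNorm Λ z ^ 2 = mSq Λ z := Real.sq_sqrt (mSq_nonneg hΛ z)
  have hy0 : 0 ≤ mNorm Λ y := Real.sqrt_nonneg _
  have h1 : s * dotR x y ≤ s * L * mNorm Λ z * mNorm Λ y := by
    calc s * dotR x y ≤ s * (L * mNorm Λ z * mNorm Λ y) := by
          gcongr
          exact (dotR_le_mInvNorm_mul_mNorm hΛ x y).trans (by gcongr)
      _ = _ := by ring
  refine h1.trans ?_
  rw [← hy, ← hz]
  have h2 := mul_le_mul_of_nonneg_right h (sq_nonneg (mNorm Λ z))
  have h3 := sq_nonneg (2 * p * mNorm Λ y - s * L * mNorm Λ z)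
  refine le_of_mul_le_mul_left ?_ (by positivity : (0 : ℝ) < 4 * p)
  nlinarith

theorem stmt6 {d : ℕ} (Λ : Fin d → ℝ) (hΛ : ∀ i, 0 < Λ i)
    (β γ μ τ : ℝ)
    (hβ0 : 0 < β) (hβ1 : β < 1) (hγ0 : 0 < γ) (hγ1 : γ < 1)
    (hμ : 0 ≤ μ) (hτ0 : 0 < τ) (hτ1 : τ < 1)
    (akm4 akm3 akm2 akm1 ak : ℝ)
    (hakm4 : 0 < akm4) (hakm3 : 0 < akm3) (hakm2 : 0 < akm2)
    (hakm1 : 0 < akm1) (hak : 0 < ak)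
    (ωkm3 ωkm2 ωkm1 : ℝ)
    (hωkm3 : 0 < ωkm3) (hωkm3' : ωkm3 ≤ 1)
    (hωkm2 : 0 < ωkm2) (hωkm2' : ωkm2 ≤ 1)
    (hωkm1 : 0 < ωkm1) (hωkm1' : ωkm1 ≤ 1)
    (θkm3 θkm2 θkm1 θk : ℝ)
    (hθkm3 : 0 < θkm3) (hθkm2 : 0 < θkm2) (hθkm1 : 0 < θkm1) (hθk : 0 < θk)
    (hθ1 : θkm1 = θk * ωkm1) (hθ2 : θkm2 = θkm1 * ωkm2) (hθ3 : θkm3 = θkm2 * ωkm3)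
    (F : (Fin d → ℝ) → (Fin d → ℝ))
    (ukm3 ukm2 ukm1 uk ukp1 : Fin d → ℝ)
    (Ftkm2 Ftkm1 Ftk : Fin d → ℝ)
    (Lk Lhkm2 Lhkm1 : ℝ)
    (hLk : 0 < Lk) (hLhkm2 : 0 < Lhkm2) (hLhkm1 : 0 < Lhkm1)
    (hLipk : mInvNorm Λ (F uk - F ukm1) ≤ Lk * mNorm Λ (uk - ukm1))
    (hLipkm1 : mInvNorm Λ (F ukm1 - Ftkm1) ≤ Lhkm1 * mNorm Λ (ukm1 - ukm2))
    (hLipkm2 : mInvNorm Λ (F ukm2 - Ftkm2) ≤ Lhkm2 * mNorm Λ (ukm2 - ukm3)) :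
    let η := Real.sqrt (γ * (1 + β) / (1 + β ^ 2))
    let Fbk : Fin d → ℝ := Ftk + (akm1 * ωkm1 / ak) • (F ukm1 - Ftkm1)
    let Fbkm1 : Fin d → ℝ := Ftkm1 + (akm2 * ωkm2 / akm1) • (F ukm2 - Ftkm2)
    let ck := θk * ak * (β * μ * akm1 + 1) / (β * akm1)
    let ckm1 := θkm1 * akm1 * (β * μ * akm2 + 1) / (β * akm2)
    let ckm2 := θkm2 * akm2 * (β * μ * akm3 + 1) / (β * akm3)
    let ckm3 := θkm3 * akm3 * (β * μ * akm4 + 1) / (β * akm4)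
    let Ek := ak * dotR (F uk - Ftk) (uk - ukp1)
      + ak * dotR (Fbk - Fbkm1) (uk - ukp1)
      - (γ * ωkm1 * (1 + β) / (2 * (1 + ωkm1) * (1 + β ^ 2))
          + ak * (1 + β * μ * akm1) / (2 * β * akm1)) * mSq Λ (ukp1 - uk)
    -- the four step size conditions
    ak ≤ η * Real.sqrt τ / (2 * Real.sqrt 3 * Lk) * (ωkm1 / Real.sqrt (1 + ωkm1)) *
        Real.sqrt (akm1 * (β * μ * akm2 + 1) / (β * akm2)) →
    ak ≤ η * Real.sqrt τ / (2 * Real.sqrt 3 * Lhkm1) *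
        (ωkm1 * Real.sqrt ωkm2 / Real.sqrt (1 + ωkm1)) *
        Real.sqrt (akm2 * (β * μ * akm3 + 1) / (β * akm3)) →
    akm1 ≤ η * Real.sqrt (1 - τ) / (2 * Lhkm1) *
        (Real.sqrt ωkm2 / Real.sqrt (1 + ωkm1)) *
        Real.sqrt (akm2 * (β * μ * akm3 + 1) / (β * akm3)) →
    ak ≤ η * Real.sqrt τ / (2 * Real.sqrt 3 * Lhkm2) * (ωkm1 / Real.sqrt (1 + ωkm1)) *
        Real.sqrt (ωkm3 / ωkm2) * (akm1 / akm2) *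
        Real.sqrt (akm3 * (β * μ * akm4 + 1) / (β * akm4)) →
    θk * Ek ≤ -(ck / 2) * mSq Λ (ukp1 - uk)
      + ckm1 / 8 * mSq Λ (uk - ukm1)
      + ckm2 / 4 * mSq Λ (ukm1 - ukm2)
      + ckm3 / 8 * mSq Λ (ukm2 - ukm3) := by

  intro η Fbk Fbkm1 ck ckm1 ckm2 ckm3 Ek h1 h2 h3 h4
  have hη : η ^ 2 = γ * (1 + β) / (1 + β ^ 2) := Real.sq_sqrt (by positivity)
  have hη0 : 0 < η := Real.sqrt_pos.2 (by positivity)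
  have hτ : 0 < 1 - τ := sub_pos.2 hτ1
  obtain ⟨κ1, hκ1⟩ : ∃ κ, κ = akm1 * (β * μ * akm2 + 1) / (β * akm2) := ⟨_, rfl⟩
  obtain ⟨κ2, hκ2⟩ : ∃ κ, κ = akm2 * (β * μ * akm3 + 1) / (β * akm3) := ⟨_, rfl⟩
  obtain ⟨κ3, hκ3⟩ : ∃ κ, κ = akm3 * (β * μ * akm4 + 1) / (β * akm4) := ⟨_, rfl⟩
  have hκ1' : 0 < κ1 := by rw [hκ1]; positivity
  have hκ2' : 0 < κ2 := by rw [hκ2]; positivity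
  have hκ3' : 0 < κ3 := by rw [hκ3]; positivity
  have hc1 : ckm1 = θk * ωkm1 * κ1 := by
    simp only [ckm1, hκ1, hθ1]; ring
  have hc2 : ckm2 = θk * ωkm1 * ωkm2 * κ2 := by
    simp only [ckm2, hκ2, hθ2, hθ1]; ring
  have hc3 : ckm3 = θk * ωkm1 * ωkm2 * ωkm3 * κ3 := by
    simp only [ckm3, hκ3, hθ3, hθ2, hθ1]; ring
  rw [← hκ1] at h1
  rw [← hκ2] at h2 h3
  rw [← hκ3] at h4
  obtain ⟨P, hP⟩ : ∃ P, P = η ^ 2 * ωkm1 / (2 * (1 + ωkm1)) := ⟨_, rfl⟩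
  have hP0 : 0 < P := by rw [hP]; positivity
  have hω : 0 ≤ 1 + ωkm1 := by positivity
  have s1 := pow_le_pow_left₀ hak.le h1 2
  have s2 := pow_le_pow_left₀ hak.le h2 2
  have s3 := pow_le_pow_left₀ hakm1.le h3 2
  have s4 := pow_le_pow_left₀ hak.le h4 2
  simp only [mul_pow, div_pow, Real.sq_sqrt, hω, hτ0.le, hτ.le, hωkm2.le, hκ1'.le, hκ2'.le,
    hκ3'.le, (div_pos hωkm3 hωkm2).le, Nat.ofNat_nonneg] at s1 s2 s3 s4
  have b1 : ak * dotR (F uk - F ukm1) (uk - ukp1)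
      ≤ τ / 3 * P * mSq Λ (uk - ukp1) + ωkm1 * κ1 / 8 * mSq Λ (uk - ukm1) := by
    refine mul_dotR_le_of_sq_le hΛ hak.le (by positivity) hLipk ?_
    rw [mul_pow]
    refine (mul_le_mul_of_nonneg_right s1 (sq_nonneg Lk)).trans (le_of_eq ?_)
    rw [hP]; field_simp; norm_num
  have b2 : ak * dotR (F ukm1 - Ftkm1) (uk - ukp1)
      ≤ τ / 3 * P * mSq Λ (uk - ukp1) + ωkm1 * ωkm2 * κ2 / 8 * mSq Λ (ukm1 - ukm2) := by
    refine mul_dotR_le_of_sq_le hΛ hak.le (by positivity) hLipkm1 ?_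
    rw [mul_pow]
    refine (mul_le_mul_of_nonneg_right s2 (sq_nonneg Lhkm1)).trans (le_of_eq ?_)
    rw [hP]; field_simp; norm_num
  have b3 : akm1 * ωkm1 * dotR (F ukm1 - Ftkm1) (uk - ukp1)
      ≤ (1 - τ) * P * mSq Λ (uk - ukp1) + ωkm1 * ωkm2 * κ2 / 8 * mSq Λ (ukm1 - ukm2) := by
    refine mul_dotR_le_of_sq_le hΛ (by positivity) (by positivity) hLipkm1 ?_
    rw [mul_pow, mul_pow]
    refine (mul_le_mul_of_nonneg_right (mul_le_mul_of_nonneg_right s3 (sq_nonneg ωkm1))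
      (sq_nonneg Lhkm1)).trans (le_of_eq ?_)
    rw [hP]; field_simp; norm_num
  have b4 : ak * (akm2 * ωkm2 / akm1) * dotR (-(F ukm2 - Ftkm2)) (uk - ukp1)
      ≤ τ / 3 * P * mSq Λ (uk - ukp1)
        + ωkm1 * ωkm2 * ωkm3 * κ3 / 8 * mSq Λ (ukm2 - ukm3) := by
    refine mul_dotR_le_of_sq_le hΛ (by positivity) (by positivity)
      ((mInvNorm_neg Λ _).trans_le hLipkm2) ?_
    rw [mul_pow, mul_pow]
    refine (mul_le_mul_of_nonneg_right (mul_le_mul_of_nonneg_right s4 (sq_nonneg _))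
      (sq_nonneg Lhkm2)).trans (le_of_eq ?_)
    rw [hP]; field_simp; norm_num
  have hsum : ak * dotR (F uk - Ftk) (uk - ukp1) + ak * dotR (Fbk - Fbkm1) (uk - ukp1)
      = ak * dotR (F uk - F ukm1) (uk - ukp1) + ak * dotR (F ukm1 - Ftkm1) (uk - ukp1)
        + akm1 * ωkm1 * dotR (F ukm1 - Ftkm1) (uk - ukp1)
        + ak * (akm2 * ωkm2 / akm1) * dotR (-(F ukm2 - Ftkm2)) (uk - ukp1) := by
    simp only [dotR, Finset.mul_sum, ← Finset.sum_add_distrib, Fbk, Fbkm1]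
    refine Finset.sum_congr rfl fun i _ => ?_
    simp only [Pi.sub_apply, Pi.add_apply, Pi.smul_apply, Pi.neg_apply, smul_eq_mul]
    field_simp
    ring
  have hcoef : γ * ωkm1 * (1 + β) / (2 * (1 + ωkm1) * (1 + β ^ 2)) = P := by
    rw [hP, hη]; field_simp
  have hck : ck / 2 = θk * (ak * (1 + β * μ * akm1) / (2 * β * akm1)) := by
    simp only [ck]; field_simp; ring
  rw [hc1, hc2, hc3, hck]
  simp only [Ek]
  rw [hsum, hcoef, mSq_sub_comm Λ ukp1 uk]
  have key := mul_le_mul_of_nonneg_left (add_le_add (add_le_add (add_le_add b1 b2) b3) b4) hθk.le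
  linarith
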